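/- arXiv:2604.05956 — 2 statements merged into one kernel-verified Lean document; each statement's English description precedes it below -/
import Mathlib

section
/- Let n ≥ 2, 1 ≤ k ≤ n−1, and let I ∈ 𝓘_k^max(n−1) have canonical decomposition into blocks of lengths m₁,…,m_s. Then the number of strictly increasing k-tuples J with entries in {1,…,n−1} such that x_J² = x_I² in F₂[x₁,…,x_{n−1}]/I(n) equals the product of Catalan numbers C_{m₁}·C_{m₂}⋯C_{m_s}. -/
open MvPolynomial

/-- The Lee–Szczarba ideal `I(n)` of `F₂[x₁,…,x_{n−1}]`, generated by
`xᵢ² + xᵢ·xᵢ₊₁` for `1 ≤ i ≤ n−2` together with `x_{n−1}²`.  Here `m = n − 1` is the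
number of variables, and the variable `x_{i+1}` (1-based) is `X i` for `i : Fin m`. -/
noncomputable def lsIdeal (m : ℕ) : Ideal (MvPolynomial (Fin m) (ZMod 2)) :=
  Ideal.span
    ({q | ∃ i j : Fin m, (j : ℕ) = (i : ℕ) + 1 ∧ q = X i ^ 2 + X i * X j} ∪
     {q | ∃ i : Fin m, (i : ℕ) = m - 1 ∧ q = X i ^ 2})

/-- `x_I`: the squarefree monomial associated to a tuple `I` (given as a map
`Fin k → Fin m` of variable indices). -/
noncomputable def xMon {m k : ℕ} (I : Fin k → Fin m) : MvPolynomial (Fin m) (ZMod 2) :=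
  ∏ j : Fin k, X (I j)

/-- The lexicographic order on `k`-tuples: `J ⪯ I` iff `J = I` or `J r < I r` at the
first index `r` where they differ. -/
def lexLe {m k : ℕ} (J I : Fin k → Fin m) : Prop :=
  J = I ∨ ∃ r : Fin k, (∀ s : Fin k, s < r → J s = I s) ∧ J r < I r

/-- The set `𝓘_k^max(m)`: strictly increasing `k`-tuples `I` with entries among the `m`
variables such that `x_I² ≠ 0` in the quotient and `J ⪯ I` for every strictly increasing
`k`-tuple `J` with `x_J² = x_I²` in the quotient. -/
noncomputable def Imax (m k : ℕ) : Set (Fin k → Fin m) :=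
  {I | StrictMono I ∧
    Ideal.Quotient.mk (lsIdeal m) (xMon I ^ 2) ≠ 0 ∧
    ∀ J : Fin k → Fin m, StrictMono J →
      Ideal.Quotient.mk (lsIdeal m) (xMon J ^ 2) =
        Ideal.Quotient.mk (lsIdeal m) (xMon I ^ 2) →
      lexLe J I}

/-- Auxiliary computation of the lengths of the blocks of the canonical decomposition of
a tuple of entries: a new block starts whenever the difference of consecutive entries is
at least `3`.  `prev` is the previous entry and `len` the length of the current block. -/
def blockLengthsAux : ℕ → ℕ → List ℕ → List ℕ
  | _, len, [] => [len]
  | prev, len, b :: rest =>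
    if prev + 3 ≤ b then len :: blockLengthsAux b 1 rest
    else blockLengthsAux b (len + 1) rest

/-- The block lengths `m₁,…,m_s` of the canonical decomposition of a tuple, given as the
list of its entries. -/
def blockLengths : List ℕ → List ℕ
  | [] => []
  | a :: rest => blockLengthsAux a 1 rest

/-- The number of cars carried past the spots `0, …, i - 1` when `e j` cars arrive at spot `j`
and every spot holds one car. -/
def carry (e : ℕ → ℕ) : ℕ → ℕ
  | 0 => 0
  | i + 1 => carry e i + e i - 1

/-- The number (`0` or `1`) of cars parked at spot `i`. -/
def occ (e : ℕ → ℕ) (i : ℕ) : ℕ := min (carry e i + e i) 1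

theorem carry_congr {e e' : ℕ → ℕ} {i : ℕ} (h : ∀ j < i, e j = e' j) : carry e i = carry e' i := by
  induction i with
  | zero => rfl
  | succ i ih => rw [carry, carry, ih fun j hj => h j (by omega), h i (by omega)]

theorem occ_congr {e e' : ℕ → ℕ} {i : ℕ} (h : ∀ j ≤ i, e j = e' j) : occ e i = occ e' i := by
  rw [occ, occ, carry_congr fun j hj => h j hj.le, h i le_rfl]

theorem sum_range_eq_sum_occ_add_carry (e : ℕ → ℕ) (i : ℕ) :
    ∑ j ∈ Finset.range i, e j = ∑ j ∈ Finset.range i, occ e j + carry e i := by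
  induction i with
  | zero => rfl
  | succ i ih =>
    rw [Finset.sum_range_succ, Finset.sum_range_succ, ih, carry, occ]
    omega

/-- The parking outcome does not change when a local modification at `i`, `i + 1` keeps both
spots filled and sends on the same number of cars. -/
theorem carry_eq_of_local {e e' : ℕ → ℕ} {i : ℕ} (h : ∀ j, j ≠ i → j ≠ i + 1 → e j = e' j)
    (hc : carry e (i + 2) = carry e' (i + 2)) {j : ℕ} (hj : j ≠ i + 1) :
    carry e j = carry e' j := by
  rcases lt_or_gt_of_ne hj with hj | hj
  · exact carry_congr fun l hl => h l (by omega) (by omega)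
  · obtain ⟨d, rfl⟩ := Nat.exists_eq_add_of_le (show i + 2 ≤ j by omega)
    clear hj
    induction d with
    | zero => exact hc
    | succ d ih =>
      rw [← add_assoc, carry, carry, ih (by omega), h _ (by omega) (by omega)]

theorem occ_eq_of_local {e e' : ℕ → ℕ} {i : ℕ} (h : ∀ j, j ≠ i → j ≠ i + 1 → e j = e' j)
    (hc : carry e (i + 2) = carry e' (i + 2)) (h0 : occ e i = occ e' i)
    (h1 : occ e (i + 1) = occ e' (i + 1)) : occ e = occ e' := by
  funext j
  by_cases hj0 : j = i
  · rw [hj0, h0]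
  by_cases hj1 : j = i + 1
  · rw [hj1, h1]
  rw [occ, occ, carry_eq_of_local h hc hj1, h j hj0 hj1]

section NormalForm

theorem pow_eq_of_sq {A : Type*} [CommRing A] {x y : A} (h : x ^ 2 = x * y) (a : ℕ) :
    x ^ a = x ^ min a 1 * y ^ (a - 1) := by
  induction a with
  | zero => simp
  | succ a ih =>
    rcases Nat.eq_zero_or_pos a with rfl | ha
    · simp
    · rw [pow_succ, ih, min_eq_right ha, min_eq_right (by omega), pow_one,
        show a + 1 - 1 = (a - 1) + 1 by omega, pow_succ]
      linear_combination y ^ (a - 1) * h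

theorem prod_pow_eq_prod_occ {A : Type*} [CommRing A] {y : ℕ → A}
    (hy : ∀ i, y i ^ 2 = y i * y (i + 1)) (e : ℕ → ℕ) (i : ℕ) :
    ∏ j ∈ Finset.range i, y j ^ e j = (∏ j ∈ Finset.range i, y j ^ occ e j) * y i ^ carry e i := by
  induction i with
  | zero => simp [carry]
  | succ i ih =>
    rw [Finset.prod_range_succ, Finset.prod_range_succ, ih, mul_assoc, ← pow_add,
      pow_eq_of_sq (hy i), ← mul_assoc, carry, occ]

/-- The image of the `i`-th variable in the quotient, extended by `0`. -/
noncomputable def quotVar (m i : ℕ) : MvPolynomial (Fin m) (ZMod 2) ⧸ lsIdeal m :=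
  if h : i < m then Ideal.Quotient.mk (lsIdeal m) (X ⟨i, h⟩) else 0

theorem quotVar_sq (m i : ℕ) : quotVar m i ^ 2 = quotVar m i * quotVar m (i + 1) := by
  by_cases h : i < m
  · by_cases h' : i + 1 < m
    · rw [← sub_eq_zero]
      simp only [quotVar, h, h', dif_pos, ← map_pow, ← map_mul, ← map_sub]
      rw [Ideal.Quotient.eq_zero_iff_mem, CharTwo.sub_eq_add]
      exact Ideal.subset_span (Or.inl ⟨_, _, rfl, rfl⟩)
    · simp only [quotVar, h, h', dif_pos, dif_neg, not_false_iff, ← map_pow, mul_zero]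
      rw [Ideal.Quotient.eq_zero_iff_mem]
      exact Ideal.subset_span (Or.inr ⟨_, by simp; omega, rfl⟩)
  · simp [quotVar, h]

/-- The monomial with exponents `e`. -/
noncomputable def expMon (m : ℕ) (e : ℕ → ℕ) : MvPolynomial (Fin m) (ZMod 2) :=
  ∏ i : Fin m, X i ^ e i

theorem mk_expMon (m : ℕ) (e : ℕ → ℕ) :
    Ideal.Quotient.mk (lsIdeal m) (expMon m e) =
      (∏ j ∈ Finset.range m, quotVar m j ^ occ e j) * 0 ^ carry e m := by
  have hm : quotVar m m = 0 := by simp [quotVar]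
  rw [← hm, ← prod_pow_eq_prod_occ (quotVar_sq m), Finset.prod_range, expMon, map_prod]
  exact Finset.prod_congr rfl fun i _ => by simp [quotVar]

/-- Exponent vectors extended by `0`. -/
def extendExp {m : ℕ} (u : Fin m →₀ ℕ) (j : ℕ) : ℕ := if h : j < m then u ⟨j, h⟩ else 0

/-- The parking outcome of an exponent vector, or `0` if some car leaves the street. -/
noncomputable def outcome {m : ℕ} (u : Fin m →₀ ℕ) : (ℕ → ℕ) →₀ ZMod 2 :=
  if carry (extendExp u) m = 0 then Finsupp.single (occ (extendExp u)) 1 else 0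

/-- The linear extension of the parking outcome to polynomials. -/
noncomputable def outcomeLin (m : ℕ) :
    MvPolynomial (Fin m) (ZMod 2) →ₗ[ZMod 2] (ℕ → ℕ) →₀ ZMod 2 :=
  (basisMonomials (Fin m) (ZMod 2)).constr (ZMod 2) outcome

theorem outcomeLin_monomial {m : ℕ} (u : Fin m →₀ ℕ) (a : ZMod 2) :
    outcomeLin m (monomial u a) = a • outcome u := by
  have : monomial u a = a • basisMonomials (Fin m) (ZMod 2) u := by simp [smul_monomial]
  rw [this, map_smul, outcomeLin, Module.Basis.constr_basis]

theorem outcome_move {m : ℕ} (u : Fin m →₀ ℕ) {i j : Fin m} (hij : (j : ℕ) = i + 1) :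
    outcome (u + Finsupp.single i 2) =
      outcome (u + (Finsupp.single i 1 + Finsupp.single j 1)) := by
  set e := extendExp (u + Finsupp.single i 2) with he
  set e' := extendExp (u + (Finsupp.single i 1 + Finsupp.single j 1)) with he'
  have hne : i ≠ j := fun h => by rw [h] at hij; omega
  have hi : e i = u i + 2 := by simp [e, extendExp]
  have hi' : e' i = u i + 1 := by simp [e', extendExp, hne]
  have hj : e (i + 1) = u j := by
    rw [← hij]; simp [e, extendExp, hne]
  have hj' : e' (i + 1) = u j + 1 := by
    rw [← hij]; simp [e', extendExp, hne]
  have hl : ∀ l, l ≠ (i : ℕ) → l ≠ i + 1 → e l = e' l := by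
    intro l h1 h2
    simp only [e, e', extendExp]
    split_ifs with h
    · have h1' : i ≠ ⟨l, h⟩ := fun h' => h1 (by rw [h'])
      have h2' : j ≠ ⟨l, h⟩ := fun h' => h2 (by rw [← hij, h'])
      simp [h1', h2']
    · rfl
  have hci : carry e i = carry e' i := carry_congr fun l h => hl l (by omega) (by omega)
  have hc : carry e (i + 2) = carry e' (i + 2) := by
    simp only [carry, hi, hi', hj, hj', hci]; omega
  have ho : occ e = occ e' := occ_eq_of_local hl hc (by simp only [occ, hi, hi', hci]; omega)
    (by simp only [occ, carry, hi, hi', hj, hj', hci]; omega)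
  have := j.isLt
  rw [outcome, outcome, ← he, ← he', ho, carry_eq_of_local hl hc (show m ≠ i + 1 by omega)]

theorem outcome_last {m : ℕ} (u : Fin m →₀ ℕ) {i : Fin m} (hi : (i : ℕ) = m - 1) :
    outcome (u + Finsupp.single i 2) = 0 := by
  refine if_neg ?_
  have hm : m = i + 1 := by have := i.isLt; omega
  have : extendExp (u + Finsupp.single i 2) i = u i + 2 := by simp [extendExp]
  conv => enter [1, 1, 2]; rw [hm]
  rw [carry, this]
  omega

theorem outcomeLin_eq_zero {m : ℕ} {q : MvPolynomial (Fin m) (ZMod 2)} (hq : q ∈ lsIdeal m) :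
    outcomeLin m q = 0 := by
  suffices h : ∀ a, outcomeLin m (a * q) = 0 by simpa using h 1
  induction hq using Submodule.span_induction with
  | mem q hq =>
    intro a
    induction a using MvPolynomial.induction_on' with
    | add p r hp hr => rw [add_mul, map_add, hp, hr, add_zero]
    | monomial u a =>
      rcases hq with ⟨i, j, hij, rfl⟩ | ⟨i, hi, rfl⟩
      · have h1 : (X i ^ 2 : MvPolynomial (Fin m) (ZMod 2)) = monomial (Finsupp.single i 2) 1 :=
          X_pow_eq_monomial
        have h2 : (X i * X j : MvPolynomial (Fin m) (ZMod 2)) =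
            monomial (Finsupp.single i 1 + Finsupp.single j 1) 1 := by
          simp [X, monomial_mul]
        rw [h1, h2, mul_add, monomial_mul, monomial_mul, map_add, outcomeLin_monomial,
          outcomeLin_monomial, outcome_move u hij, ← add_smul, CharTwo.add_self_eq_zero, zero_smul]
      · rw [X_pow_eq_monomial, monomial_mul, outcomeLin_monomial, outcome_last u hi, smul_zero]
  | zero => simp
  | add x y _ _ hx hy => intro a; rw [mul_add, map_add, hx, hy, add_zero]
  | smul b x _ hx => intro a; rw [smul_eq_mul, ← mul_assoc, hx]

theorem outcomeLin_expMon {m : ℕ} {e : ℕ → ℕ} (he : ∀ j, m ≤ j → e j = 0) :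
    outcomeLin m (expMon m e) = if carry e m = 0 then Finsupp.single (occ e) 1 else 0 := by
  have h1 : expMon m e = monomial (Finsupp.equivFunOnFinite.symm fun i : Fin m => e i) 1 := by
    rw [monomial_eq, Finsupp.prod_fintype _ _ (by simp)]
    simp [expMon]
  have h2 : extendExp (Finsupp.equivFunOnFinite.symm fun i : Fin m => e i) = e := by
    funext j
    by_cases hj : j < m
    · simp [extendExp, hj]
    · simp [extendExp, hj, he j (by omega)]
  rw [h1, outcomeLin_monomial, one_smul, outcome, h2]

theorem mk_expMon_eq_iff {m : ℕ} {e e' : ℕ → ℕ} (he : ∀ j, m ≤ j → e j = 0)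
    (he' : ∀ j, m ≤ j → e' j = 0) (h0 : carry e m = 0) :
    Ideal.Quotient.mk (lsIdeal m) (expMon m e') = Ideal.Quotient.mk (lsIdeal m) (expMon m e) ↔
      (∀ j < m, occ e' j = occ e j) ∧ carry e' m = 0 := by
  constructor
  · intro h
    have h1 := outcomeLin_eq_zero (Ideal.Quotient.eq.1 h)
    rw [map_sub, outcomeLin_expMon he, outcomeLin_expMon he', if_pos h0, sub_eq_zero] at h1
    split_ifs at h1 with hc
    · rw [Finsupp.single_left_inj one_ne_zero] at h1
      exact ⟨fun j _ => congrFun h1 j, hc⟩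
    · exact absurd h1.symm (by simp)
  · rintro ⟨h1, h2⟩
    rw [mk_expMon, mk_expMon, h0, h2]
    congr 1
    exact Finset.prod_congr rfl fun j hj => by rw [h1 j (Finset.mem_range.1 hj)]

end NormalForm

section Counting

/-- The number of nonnegative lattice paths with `L` steps `±1` from `0` to `h`. -/
def ballot : ℕ → ℕ → ℕ
  | 0, 0 => 1
  | 0, _ + 1 => 0
  | L + 1, 0 => ballot L 1
  | L + 1, h + 1 => ballot L h + ballot L (h + 2)

theorem ballot_eq_zero {L h : ℕ} (hL : L < h) : ballot L h = 0 := by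
  induction L generalizing h with
  | zero => cases h with
    | zero => omega
    | succ h => rfl
  | succ L ih => cases h with
    | zero => omega
    | succ h => rw [ballot, ih (by omega), ih (by omega)]

theorem ballot_self (h : ℕ) : ballot h h = 1 := by
  induction h with
  | zero => rfl
  | succ h ih => rw [ballot, ih, ballot_eq_zero (by omega)]

theorem ballot_add_choose (L d h : ℕ) (hL : L = h + 2 * (d + 1)) :
    ballot L h + L.choose d = L.choose (d + 1) := by
  induction L generalizing d h with
  | zero => omega
  | succ L ih =>
    cases h with
    | zero =>
      cases d with
      | zero =>
        obtain rfl : L = 1 := by omega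
        rfl
      | succ d =>
        have h1 := ih d 1 (by omega)
        have h2 : L.choose (d + 1 + 1) = L.choose (d + 1) := by
          rw [← Nat.choose_symm_of_eq_add (show L = (d + 1 + 1) + (d + 1) by omega)]
        rw [ballot, Nat.choose_succ_succ' L d, Nat.choose_succ_succ' L (d + 1)]
        omega
    | succ h =>
      have h1 := ih d h (by omega)
      cases d with
      | zero =>
        have : ballot L (h + 2) = 1 := by rw [show L = h + 2 by omega, ballot_self]
        rw [ballot, this, Nat.choose_succ_succ' L 0]
        simp only [Nat.choose_zero_right] at *
        omega
      | succ d =>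
        have h2 := ih d (h + 2) (by omega)
        rw [ballot, Nat.choose_succ_succ' L d, Nat.choose_succ_succ' L (d + 1)]
        omega

theorem ballot_two_mul_zero (n : ℕ) : ballot (2 * n) 0 = catalan n := by
  cases n with
  | zero => rw [catalan_zero]; rfl
  | succ d =>
    have h1 := ballot_add_choose (2 * (d + 1)) d 0 (by omega)
    have h2 := succ_mul_catalan_eq_centralBinom (d + 1)
    have h3 := Nat.choose_succ_right_eq (2 * (d + 1)) d
    rw [Nat.centralBinom_eq_two_mul_choose, ← h1] at h2
    rw [← h1, show 2 * (d + 1) - d = d + 2 by omega] at h3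
    refine Nat.eq_of_mul_eq_mul_left (show 0 < d + 1 + 1 by omega) ?_
    rw [h2]
    linarith

/-- The exponent vector of `x_S²`. -/
def dbl (S : Finset ℕ) (j : ℕ) : ℕ := if j ∈ S then 2 else 0

/-- The subsets of `{0, …, i - 1}` whose doubles park with outcome `p` and carry `h`. -/
def parkFiber (p : ℕ → ℕ) (i h : ℕ) : Finset (Finset ℕ) :=
  {S ∈ (Finset.range i).powerset | (∀ j < i, occ (dbl S) j = p j) ∧ carry (dbl S) i = h}

theorem dbl_insert_of_ne {S : Finset ℕ} {i j : ℕ} (h : j ≠ i) : dbl (insert i S) j = dbl S j := by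
  simp [dbl, h]

theorem card_parkFiber_succ (p : ℕ → ℕ) (i h : ℕ) :
    (parkFiber p (i + 1) h).card =
      (if p i = 1 ∧ h ≠ 0 then (parkFiber p i (h - 1)).card else 0) +
      ((if p i = 1 then (parkFiber p i (h + 1)).card else 0) +
      (if p i = 0 ∧ h = 0 then (parkFiber p i 0).card else 0)) := by
  have hi : i ∉ Finset.range i := by simp
  have hins (S : Finset ℕ) : ((∀ j < i + 1, occ (dbl (insert i S)) j = p j) ∧
      carry (dbl (insert i S)) (i + 1) = h) ↔
      (p i = 1 ∧ h ≠ 0) ∧ (∀ j < i, occ (dbl S) j = p j) ∧ carry (dbl S) i = h - 1 := by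
    have hcong : ∀ j < i, occ (dbl (insert i S)) j = occ (dbl S) j := fun j hj =>
      occ_congr fun l hl => dbl_insert_of_ne (by omega)
    have hcarry : carry (dbl (insert i S)) i = carry (dbl S) i :=
      carry_congr fun l hl => dbl_insert_of_ne (by omega)
    have hi2 : dbl (insert i S) i = 2 := if_pos (Finset.mem_insert_self i S)
    rw [Nat.forall_lt_succ_right, forall₂_congr fun j hj => by rw [hcong j hj], occ, carry,
      hcarry, hi2]
    refine ⟨fun ⟨⟨h1, h2⟩, h3⟩ => ⟨⟨?_, ?_⟩, h1, ?_⟩, fun ⟨⟨h1, h2⟩, h3, h4⟩ => ⟨⟨h3, ?_⟩, ?_⟩⟩ <;>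
      omega
  have hnot (S : Finset ℕ) (hS : S ⊆ Finset.range i) : ((∀ j < i + 1, occ (dbl S) j = p j) ∧
      carry (dbl S) (i + 1) = h) ↔
      (p i = 1 ∧ (∀ j < i, occ (dbl S) j = p j) ∧ carry (dbl S) i = h + 1) ∨
      ((p i = 0 ∧ h = 0) ∧ (∀ j < i, occ (dbl S) j = p j) ∧ carry (dbl S) i = 0) := by
    have hi0 : dbl S i = 0 := if_neg fun h => hi (hS h)
    rw [Nat.forall_lt_succ_right, occ, carry, hi0]
    constructor
    · rintro ⟨⟨h1, h2⟩, h3⟩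
      by_cases hc : carry (dbl S) i = 0
      · exact Or.inr ⟨by omega, h1, hc⟩
      · exact Or.inl ⟨by omega, h1, by omega⟩
    · rintro (⟨h1, h2, h3⟩ | ⟨h1, h2, h3⟩) <;> exact ⟨⟨h2, by omega⟩, by omega⟩
  simp only [parkFiber, Finset.card_filter]
  rw [Finset.range_add_one, Finset.sum_powerset_insert hi, add_comm]
  congr 1
  · simp only [hins]
    split_ifs with h1 <;> simp [h1]
  · rw [Finset.sum_congr rfl fun S hS =>
      if_congr (hnot S (Finset.mem_powerset.1 hS)) rfl rfl]
    split_ifs with h1 h2 h2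
    · omega
    · simp [h1]
    · simp [h2]
    · simp [h1, h2]

theorem card_parkFiber_succ_of_eq_one {p : ℕ → ℕ} {i A L : ℕ} (hp : p i = 1)
    (hF : ∀ h, (parkFiber p i h).card = A * ballot L h) (h : ℕ) :
    (parkFiber p (i + 1) h).card = A * ballot (L + 1) h := by
  rw [card_parkFiber_succ]
  cases h with
  | zero => simp [hp, hF, ballot]
  | succ h => simp [hp, hF, ballot, mul_add]

theorem card_parkFiber_succ_of_eq_zero {p : ℕ → ℕ} {i A L : ℕ} (hp : p i = 0)
    (hF : ∀ h, (parkFiber p i h).card = A * ballot L h) (h : ℕ) :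
    (parkFiber p (i + 1) h).card = A * ballot L 0 * ballot 0 h := by
  rw [card_parkFiber_succ]
  cases h with
  | zero => simp [hp, hF, ballot]
  | succ h => simp [hp, ballot]

theorem card_parkFiber_of_forall_eq_zero {p : ℕ → ℕ} {a b A : ℕ} (hab : a ≤ b)
    (hp : ∀ i, a ≤ i → i < b → p i = 0)
    (hF : ∀ h, (parkFiber p a h).card = A * ballot 0 h) (h : ℕ) :
    (parkFiber p b h).card = A * ballot 0 h := by
  induction b, hab using Nat.le_induction generalizing h with
  | base => exact hF h
  | succ b hab ih =>
    rw [card_parkFiber_succ_of_eq_zero (hp b hab (by omega))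
      (ih fun i h1 h2 => hp i h1 (by omega)) h]
    simp [ballot]

theorem card_parkFiber_eq_prod_blockLengthsAux {p : ℕ → ℕ} {m : ℕ} (rest : List ℕ)
    (prev len A : ℕ) (hgap : (prev :: rest).Pairwise fun a b => a + 2 ≤ b)
    (hm : ∀ x ∈ prev :: rest, x + 2 ≤ m)
    (hp : ∀ i, prev + 2 ≤ i → p i = if ∃ x ∈ rest, i = x ∨ i = x + 1 then 1 else 0)
    (hF : ∀ h, (parkFiber p (prev + 2) h).card = A * ballot (2 * len) h) :
    (parkFiber p m 0).card = A * ((blockLengthsAux prev len rest).map catalan).prod := by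
  induction rest generalizing prev len A with
  | nil =>
    have hpm := hm prev (by simp)
    have h0 : ∀ i, prev + 2 ≤ i → p i = 0 := fun i hi => by simp [hp i hi]
    rcases hpm.eq_or_lt with rfl | hlt
    · simp [hF, blockLengthsAux, ballot_two_mul_zero]
    · rw [card_parkFiber_of_forall_eq_zero (show prev + 3 ≤ m by omega)
        (fun i hi _ => h0 i (by omega)) (card_parkFiber_succ_of_eq_zero (h0 _ le_rfl) hF)]
      simp [blockLengthsAux, ballot, ballot_two_mul_zero]
  | cons b rest ih =>
    rw [List.pairwise_cons] at hgap
    have hb := hgap.1 b (by simp)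
    have hrest := List.pairwise_cons.1 hgap.2
    have hpb : p b = 1 := by rw [hp b hb, if_pos ⟨b, by simp, Or.inl rfl⟩]
    have hpb' : p (b + 1) = 1 := by
      rw [hp (b + 1) (by omega), if_pos ⟨b, by simp, Or.inr rfl⟩]
    have hp' : ∀ i, b + 2 ≤ i → p i = if ∃ x ∈ rest, i = x ∨ i = x + 1 then 1 else 0 := by
      intro i hi
      rw [hp i (by omega)]
      have h1 : i ≠ b := by omega
      have h2 : i ≠ b + 1 := by omega
      simp [h1, h2]
    have hm' : ∀ x ∈ b :: rest, x + 2 ≤ m := fun x hx => hm x (List.mem_cons_of_mem _ hx)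
    rw [blockLengthsAux]
    split_ifs with h3
    · have h0 : ∀ i, prev + 2 ≤ i → i < b → p i = 0 := by
        intro i hi hib
        rw [hp i hi, if_neg]
        rintro ⟨x, hx, h⟩
        rcases List.mem_cons.1 hx with rfl | hx
        · omega
        · have := hrest.1 x hx
          omega
      have h4 := card_parkFiber_of_forall_eq_zero h3 (fun i hi => h0 i (by omega))
        (card_parkFiber_succ_of_eq_zero (h0 _ le_rfl (by omega)) hF)
      rw [ih b 1 _ hgap.2 hm' hp' (card_parkFiber_succ_of_eq_one hpb'
        (card_parkFiber_succ_of_eq_one hpb h4)), ballot_two_mul_zero]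
      simp [mul_assoc]
    · obtain rfl : b = prev + 2 := by omega
      exact ih (prev + 2) (len + 1) A hgap.2 hm' hp' (card_parkFiber_succ_of_eq_one hpb'
        (card_parkFiber_succ_of_eq_one hpb hF))

theorem card_parkFiber_eq_prod_blockLengths {p : ℕ → ℕ} {m : ℕ} {l : List ℕ} (hl : l ≠ [])
    (hgap : l.Pairwise fun a b => a + 2 ≤ b) (hm : ∀ x ∈ l, x + 2 ≤ m)
    (hp : ∀ i, p i = if ∃ x ∈ l, i = x ∨ i = x + 1 then 1 else 0) :
    (parkFiber p m 0).card = ((blockLengths l).map catalan).prod := by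
  cases l with
  | nil => exact absurd rfl hl
  | cons a rest =>
    have hrest := List.pairwise_cons.1 hgap
    have hF : ∀ h, (parkFiber p 0 h).card = 1 * ballot 0 h := by
      intro h
      cases h with
      | zero => simp [parkFiber, carry, ballot]
      | succ h => simp [parkFiber, carry, ballot]
    have h0 : ∀ i, 0 ≤ i → i < a → p i = 0 := by
      intro i _ hia
      rw [hp i, if_neg]
      rintro ⟨x, hx, h⟩
      rcases List.mem_cons.1 hx with rfl | hx
      · omega
      · have := hrest.1 x hx
        omega
    have hpa : p a = 1 := by rw [hp a, if_pos ⟨a, by simp, Or.inl rfl⟩]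
    have hpa' : p (a + 1) = 1 := by rw [hp (a + 1), if_pos ⟨a, by simp, Or.inr rfl⟩]
    have hp' : ∀ i, a + 2 ≤ i → p i = if ∃ x ∈ rest, i = x ∨ i = x + 1 then 1 else 0 := by
      intro i hi
      rw [hp i]
      have h1 : i ≠ a := by omega
      have h2 : i ≠ a + 1 := by omega
      simp [h1, h2]
    rw [blockLengths, card_parkFiber_eq_prod_blockLengthsAux rest a 1 1 hgap hm hp'
      (card_parkFiber_succ_of_eq_one hpa' (card_parkFiber_succ_of_eq_one hpa
        (card_parkFiber_of_forall_eq_zero (Nat.zero_le a) h0 hF))), one_mul]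

end Counting

section Tuples

variable {m k : ℕ}

/-- The set of entries of a tuple. -/
def entries (J : Fin k → Fin m) : Finset ℕ := Finset.univ.image fun r => (J r : ℕ)

theorem mem_entries {J : Fin k → Fin m} {i : ℕ} : i ∈ entries J ↔ ∃ r, (J r : ℕ) = i := by
  simp [entries]

theorem coe_mem_entries {J : Fin k → Fin m} {i : Fin m} :
    (i : ℕ) ∈ entries J ↔ i ∈ Finset.univ.image J := by
  simp [entries, Fin.ext_iff]

theorem lt_of_mem_entries {J : Fin k → Fin m} {i : ℕ} (hi : i ∈ entries J) : i < m := by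
  obtain ⟨r, rfl⟩ := mem_entries.1 hi
  exact (J r).isLt

theorem dbl_entries_eq_zero (J : Fin k → Fin m) (j : ℕ) (hj : m ≤ j) : dbl (entries J) j = 0 :=
  if_neg fun h => (lt_of_mem_entries h).not_ge hj

theorem xMon_sq {J : Fin k → Fin m} (hJ : StrictMono J) :
    xMon J ^ 2 = expMon m (dbl (entries J)) := by
  rw [xMon, expMon, ← Finset.prod_pow, ← Finset.prod_subset (Finset.subset_univ
    (Finset.univ.image J)), Finset.prod_image hJ.injective.injOn]
  · refine Finset.prod_congr rfl fun r _ => ?_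
    rw [dbl, if_pos (mem_entries.2 ⟨r, rfl⟩)]
  · intro i _ hi
    rw [dbl, if_neg (mt coe_mem_entries.1 hi), pow_zero]

theorem carry_eq_zero_of_ne_zero {I : Fin k → Fin m} (hI : StrictMono I)
    (h : Ideal.Quotient.mk (lsIdeal m) (xMon I ^ 2) ≠ 0) : carry (dbl (entries I)) m = 0 := by
  by_contra hc
  rw [xMon_sq hI, mk_expMon, zero_pow hc, mul_zero] at h
  exact h rfl

theorem mk_xMon_sq_eq_iff {I J : Fin k → Fin m} (hI : StrictMono I) (hJ : StrictMono J)
    (h : carry (dbl (entries I)) m = 0) :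
    Ideal.Quotient.mk (lsIdeal m) (xMon J ^ 2) = Ideal.Quotient.mk (lsIdeal m) (xMon I ^ 2) ↔
      (∀ j < m, occ (dbl (entries J)) j = occ (dbl (entries I)) j) ∧
        carry (dbl (entries J)) m = 0 := by
  rw [xMon_sq hI, xMon_sq hJ]
  exact mk_expMon_eq_iff (dbl_entries_eq_zero I) (dbl_entries_eq_zero J) h

theorem entries_injOn : Set.InjOn (entries : (Fin k → Fin m) → Finset ℕ) {J | StrictMono J} := by
  intro J hJ J' hJ' h
  refine (StrictMono.range_inj hJ hJ').1 (Set.ext fun i => ?_)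
  have := congrArg (fun S => (i : ℕ) ∈ S) h
  simpa [coe_mem_entries] using this

theorem exists_entries_eq {S : Finset ℕ} (hS : S ⊆ Finset.range m) (hk : S.card = k) :
    ∃ J : Fin k → Fin m, StrictMono J ∧ entries J = S := by
  refine ⟨fun r => ⟨S.orderEmbOfFin hk r, Finset.mem_range.1 (hS (S.orderEmbOfFin_mem hk r))⟩,
    fun a b hab => (S.orderEmbOfFin hk).strictMono hab, ?_⟩
  rw [entries]
  exact Finset.image_orderEmbOfFin_univ S hk

theorem card_entries {J : Fin k → Fin m} (hJ : StrictMono J) : (entries J).card = k :=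
  (Finset.card_image_of_injective _ (Fin.val_injective.comp hJ.injective)).trans (by simp)

theorem sum_dbl {S : Finset ℕ} (hS : S ⊆ Finset.range m) :
    ∑ j ∈ Finset.range m, dbl S j = 2 * S.card := by
  simp only [dbl]
  rw [← Finset.sum_filter, Finset.filter_mem_eq_inter, Finset.inter_eq_right.2 hS,
    Finset.sum_const, smul_eq_mul, mul_comm]

theorem card_eq_card_parkFiber {I : Fin k → Fin m} (hI : StrictMono I)
    (h : carry (dbl (entries I)) m = 0) :
    Nat.card {J : Fin k → Fin m // StrictMono J ∧ Ideal.Quotient.mk (lsIdeal m) (xMon J ^ 2) =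
      Ideal.Quotient.mk (lsIdeal m) (xMon I ^ 2)} =
      (parkFiber (occ (dbl (entries I))) m 0).card := by
  have hsub (J : Fin k → Fin m) : entries J ⊆ Finset.range m := fun i hi =>
    Finset.mem_range.2 (lt_of_mem_entries hi)
  have himage : (parkFiber (occ (dbl (entries I))) m 0 : Set (Finset ℕ)) =
      entries '' {J : Fin k → Fin m | StrictMono J ∧ Ideal.Quotient.mk (lsIdeal m) (xMon J ^ 2) =
        Ideal.Quotient.mk (lsIdeal m) (xMon I ^ 2)} := by
    ext S
    simp only [parkFiber, Finset.coe_filter, Finset.mem_powerset, Set.mem_ofPred_eq, Set.mem_image]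
    constructor
    · rintro ⟨hS, ho, hc⟩
      have h1 := sum_range_eq_sum_occ_add_carry (dbl S) m
      have h2 := sum_range_eq_sum_occ_add_carry (dbl (entries I)) m
      rw [sum_dbl hS, hc, Finset.sum_congr rfl fun j hj => ho j (Finset.mem_range.1 hj)] at h1
      rw [sum_dbl (hsub I), h, card_entries hI, ← h1] at h2
      obtain ⟨J, hJ, rfl⟩ := exists_entries_eq hS (show S.card = k by omega)
      exact ⟨J, ⟨hJ, (mk_xMon_sq_eq_iff hI hJ h).2 ⟨ho, hc⟩⟩, rfl⟩
    · rintro ⟨J, ⟨hJ, hq⟩, rfl⟩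
      exact ⟨hsub J, (mk_xMon_sq_eq_iff hI hJ h).1 hq⟩
  rw [← Set.ncard_coe_finset, himage,
    (entries_injOn.mono fun J hJ => hJ.1).ncard_image]
  rfl

theorem carry_eq_zero_of_mem_entries {I : Fin k → Fin m} (hI : I ∈ Imax m k) {i : ℕ}
    (hi : i ∈ entries I) : carry (dbl (entries I)) i = 0 := by
  obtain ⟨hmono, hne, hmax⟩ := hI
  have hm := carry_eq_zero_of_ne_zero hmono hne
  by_contra hc
  obtain ⟨i, hi', hlast⟩ := ({j ∈ entries I | carry (dbl (entries I)) j ≠ 0}).exists_max_image id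
    ⟨i, Finset.mem_filter.2 ⟨hi, hc⟩⟩
  clear hi hc
  obtain ⟨hi, hc⟩ := Finset.mem_filter.1 hi'
  have hdi : dbl (entries I) i = 2 := if_pos hi
  have hi1 : i + 1 ∉ entries I := by
    intro h
    have := hlast (i + 1) (Finset.mem_filter.2 ⟨h, by rw [carry, hdi]; omega⟩)
    simp at this
  have hdi1 : dbl (entries I) (i + 1) = 0 := if_neg hi1
  have him : i + 1 ≠ m := by
    rintro rfl
    rw [carry, hdi] at hm
    omega
  have him' : i + 1 < m := by
    have := lt_of_mem_entries hi
    omega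
  let J : Fin k → Fin m := fun r => if (I r : ℕ) = i then ⟨i + 1, him'⟩ else I r
  have hJval (r : Fin k) : (J r : ℕ) = if (I r : ℕ) = i then i + 1 else I r := by
    simp only [J]
    split_ifs <;> rfl
  have hJ : StrictMono J := by
    intro a b hab
    have h1 : (I a : ℕ) < I b := hmono hab
    have h2 : (I b : ℕ) ≠ i + 1 := fun h => hi1 (mem_entries.2 ⟨b, h⟩)
    rw [Fin.lt_def, hJval, hJval]
    split_ifs <;> omega
  have hmem (j : ℕ) : j ∈ entries J ↔ j = i + 1 ∨ (j ≠ i ∧ j ∈ entries I) := by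
    simp only [mem_entries, hJval]
    constructor
    · rintro ⟨r, rfl⟩
      split_ifs with h
      · exact Or.inl rfl
      · exact Or.inr ⟨h, r, rfl⟩
    · rintro (rfl | ⟨h, r, rfl⟩)
      · obtain ⟨r, hr⟩ := mem_entries.1 hi
        exact ⟨r, if_pos hr⟩
      · exact ⟨r, if_neg h⟩
  have hdJ : dbl (entries J) i = 0 := if_neg (by simp [hmem])
  have hdJ1 : dbl (entries J) (i + 1) = 2 := if_pos (by simp [hmem])
  have hl : ∀ j, j ≠ i → j ≠ i + 1 → dbl (entries J) j = dbl (entries I) j := by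
    intro j h1 h2
    simp [dbl, hmem, h1, h2]
  have hci : carry (dbl (entries J)) i = carry (dbl (entries I)) i :=
    carry_congr fun j hj => hl j (by omega) (by omega)
  have hc2 : carry (dbl (entries J)) (i + 2) = carry (dbl (entries I)) (i + 2) := by
    simp only [carry, hdi, hdi1, hdJ, hdJ1, hci]
    omega
  have ho : occ (dbl (entries J)) = occ (dbl (entries I)) :=
    occ_eq_of_local hl hc2 (by simp only [occ, hdi, hdJ, hci]; omega)
      (by simp only [occ, carry, hdi, hdi1, hdJ, hdJ1, hci]; omega)
  have hle := hmax J hJ ((mk_xMon_sq_eq_iff hmono hJ hm).2 ⟨fun j _ => by rw [ho], by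
    rw [carry_eq_of_local hl hc2 him.symm, hm]⟩)
  rcases hle with hJI | ⟨r, _, hr⟩
  · exact hi1 (hJI ▸ (hmem (i + 1)).2 (Or.inl rfl))
  · rw [Fin.lt_def, hJval] at hr
    split_ifs at hr <;> omega

theorem carry_succ_of_forall_mem {S : Finset ℕ} (h : ∀ i ∈ S, carry (dbl S) i = 0) (i : ℕ) :
    carry (dbl S) (i + 1) = if i ∈ S then 1 else 0 := by
  induction i with
  | zero => by_cases h0 : 0 ∈ S <;> simp [carry, dbl, h0]
  | succ i ih =>
    rw [carry]
    by_cases h1 : i + 1 ∈ S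
    · rw [h _ h1, dbl, if_pos h1, if_pos h1]
    · rw [ih, dbl, if_neg h1, if_neg h1]
      split_ifs <;> rfl

theorem occ_of_forall_mem {S : Finset ℕ} (h : ∀ i ∈ S, carry (dbl S) i = 0) (i : ℕ) :
    occ (dbl S) i = if ∃ x ∈ S, i = x ∨ i = x + 1 then 1 else 0 := by
  cases i with
  | zero => by_cases h0 : 0 ∈ S <;> simp [occ, carry, dbl, h0]
  | succ i =>
    rw [occ, carry_succ_of_forall_mem h, dbl]
    by_cases h0 : i ∈ S <;> by_cases h1 : i + 1 ∈ S <;> simp [h0, h1]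
    all_goals grind

end Tuples

/-- Let `n ≥ 2`, `1 ≤ k ≤ n−1`, and let `I ∈ 𝓘_k^max(n−1)` have
canonical decomposition with block lengths `m₁,…,m_s`.  Then the number of strictly
increasing `k`-tuples `J` with entries in `{1,…,n−1}` such that `x_J² = x_I²` in
`F₂[x₁,…,x_{n−1}]/I(n)` equals the product `C_{m₁}·C_{m₂}⋯C_{m_s}` of Catalan numbers. -/
theorem stmt15 (n k : ℕ) (hn : 2 ≤ n) (hk1 : 1 ≤ k) (hk2 : k ≤ n - 1)
    (I : Fin k → Fin (n - 1)) (hI : I ∈ Imax (n - 1) k) :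
    Nat.card {J : Fin k → Fin (n - 1) // StrictMono J ∧
        Ideal.Quotient.mk (lsIdeal (n - 1)) (xMon J ^ 2) =
          Ideal.Quotient.mk (lsIdeal (n - 1)) (xMon I ^ 2)} =
      ((blockLengths ((List.ofFn I).map Fin.val)).map catalan).prod := by
  obtain ⟨hmono, hne, -⟩ := id hI
  have hm := carry_eq_zero_of_ne_zero hmono hne
  have hzero := fun i => carry_eq_zero_of_mem_entries hI (i := i)
  have hsucc := carry_succ_of_forall_mem hzero
  have hnot {i : ℕ} (hi : i ∈ entries I) : i + 1 ∉ entries I := fun h => by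
    have := hsucc i
    rw [hzero _ h, if_pos hi] at this
    omega
  have hmem (x : ℕ) : x ∈ (List.ofFn I).map Fin.val ↔ x ∈ entries I := by
    simp [mem_entries]
  rw [card_eq_card_parkFiber hmono hm]
  refine card_parkFiber_eq_prod_blockLengths ?_ ?_ ?_ ?_
  · simpa using (by omega : k ≠ 0)
  · rw [List.pairwise_map, List.pairwise_ofFn]
    intro a b hab
    have h1 : (I a : ℕ) < I b := hmono hab
    have h2 : (I b : ℕ) ≠ I a + 1 := fun h =>
      hnot (mem_entries.2 ⟨a, rfl⟩) (mem_entries.2 ⟨b, h⟩)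
    omega
  · intro x hx
    rw [hmem] at hx
    have h1 := lt_of_mem_entries hx
    have h2 : x + 1 ≠ n - 1 := fun h => by
      have := hsucc x
      rw [h, hm, if_pos hx] at this
      omega
    omega
  · intro i
    simp only [hmem]
    exact occ_of_forall_mem hzero i
end

section
/- In the quotient ring F₂[x₁,…,x_{n−1}]/Î(n) the following hold: (1) for n ≥ 5 the image of σ₂ is nonzero; (2) for n ≥ 6 the image of σ₃ is nonzero; (3) for n ≥ 8 the image of σ₂² is nonzero; (4) for n ≥ 10 the image of σ₅ is nonzero; (5) for n ≥ 16 the image of σ₄² is nonzero. (Via the identification of F₂[x₁,…,x_{n−1}]/Î(n) with a subring of H*(L̂S_n;F₂) under which σ_j maps to the Stiefel–Whitney class w_j(L̂S_n) of the orientable double cover L̂S_n of the Lee–Szczarba flat n-manifold, these express: L̂S_n is non-spin for n ≥ 5, non-spin^c for n ≥ 6, has p₁ ≠ 0 for n ≥ 8, is non-spin^h for n ≥ 10, and has p₂ ≠ 0 for n ≥ 16.) -/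
open MvPolynomial

/-- The ideal `Î(n)` of `F₂[x₁,…,x_{n−1}]`, generated by `I(n)` together with
`x₁ + x₂ + ⋯ + x_{n−1}`. -/
noncomputable def lsIdealHat (m : ℕ) : Ideal (MvPolynomial (Fin m) (ZMod 2)) :=
  lsIdeal m ⊔ Ideal.span {∑ i : Fin m, X i}

/-! ### Nonvanishing of the top squarefree monomial -/

/-- The sum of the first `k` exponents in `e`. -/
def prefixSum {m : ℕ} (e : Fin m →₀ ℕ) (k : ℕ) : ℕ :=
  ∑ t : Fin m, if (t : ℕ) < k then e t else 0

theorem prefixSum_add_single {m : ℕ} (e : Fin m →₀ ℕ) (i : Fin m) (k : ℕ) :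
    prefixSum (e + Finsupp.single i 1) k = prefixSum e k + if (i : ℕ) < k then 1 else 0 := by
  have h : ∀ t : Fin m, (if (t : ℕ) < k then (e + Finsupp.single i 1 : Fin m →₀ ℕ) t else 0) =
      (if (t : ℕ) < k then e t else 0) + if t = i then (if (i : ℕ) < k then 1 else 0) else 0 := by
    intro t
    by_cases hti : t = i
    · subst hti
      by_cases hk : (t : ℕ) < k <;> simp [hk]
    · simp [hti]
  rw [prefixSum, Finset.sum_congr rfl fun t _ => h t, Finset.sum_add_distrib]
  simp [prefixSum]

theorem prefixSum_mono {m : ℕ} (e : Fin m →₀ ℕ) : Monotone (prefixSum e) := by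
  intro k l hkl
  refine Finset.sum_le_sum fun t _ => ?_
  split_ifs <;> omega

/-- The exponent vectors whose normal form modulo `lsIdeal m` is `x₁⋯x_m`: the exponents sum to
`m`, and the first `k` of them sum to at least `k`, for every `k`. -/
def IsTopExponent {m : ℕ} (e : Fin m →₀ ℕ) : Prop :=
  (∀ k ≤ m, k ≤ prefixSum e k) ∧ prefixSum e m = m

theorem isTopExponent_carry {m : ℕ} (e : Fin m →₀ ℕ) {i j : Fin m} (hij : (j : ℕ) = i + 1) :
    IsTopExponent (e + Finsupp.single i 1 + Finsupp.single i 1) ↔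
      IsTopExponent (e + Finsupp.single i 1 + Finsupp.single j 1) := by
  have hj := j.isLt
  have hm : prefixSum e i ≤ prefixSum e (i + 1) := prefixSum_mono e (Nat.le_succ i)
  simp only [IsTopExponent, prefixSum_add_single]
  refine and_congr ⟨fun h k hk => ?_, fun h k hk => ?_⟩ ?_
  · have h1 := h k hk
    have h2 := h i (by omega)
    by_cases hki : k = i + 1
    · subst hki
      rw [if_neg (lt_irrefl _)] at h2
      rw [if_pos (Nat.lt_succ_self _)]
      split_ifs <;> omega
    · split_ifs at * <;> omega
  · have h1 := h k hk
    split_ifs at * <;> omega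
  · rw [if_pos i.isLt, if_pos hj]

theorem not_isTopExponent_last {m : ℕ} (e : Fin m →₀ ℕ) {i : Fin m} (hi : (i : ℕ) = m - 1) :
    ¬ IsTopExponent (e + Finsupp.single i 1 + Finsupp.single i 1) := by
  have hlt := i.isLt
  have hm := prefixSum_mono e (Nat.sub_le m 1)
  simp only [IsTopExponent, prefixSum_add_single]
  rintro ⟨h1, h2⟩
  have h3 := h1 (m - 1) (Nat.sub_le m 1)
  rw [if_pos hlt] at h2
  rw [if_neg (by omega)] at h3
  omega

open Classical in
/-- The linear functional summing the coefficients of the monomials that reduce to the top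
squarefree monomial modulo `lsIdeal m`. -/
noncomputable def topCoeff (m : ℕ) : MvPolynomial (Fin m) (ZMod 2) →ₗ[ZMod 2] ZMod 2 :=
  (basisMonomials (Fin m) (ZMod 2)).constr (ZMod 2) fun e => if IsTopExponent e then 1 else 0

open Classical in
theorem topCoeff_monomial {m : ℕ} (e : Fin m →₀ ℕ) :
    topCoeff m (monomial e 1) = if IsTopExponent e then 1 else 0 := by
  have h : (monomial e 1 : MvPolynomial (Fin m) (ZMod 2)) = basisMonomials (Fin m) (ZMod 2) e := by
    rw [coe_basisMonomials]
  rw [h, topCoeff, Module.Basis.constr_basis]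

theorem monomial_mul_X_mul_X {m : ℕ} (e : Fin m →₀ ℕ) (i j : Fin m) :
    (monomial e 1 * (X i * X j) : MvPolynomial (Fin m) (ZMod 2)) =
      monomial (e + Finsupp.single i 1 + Finsupp.single j 1) 1 := by
  simp [X, monomial_mul, add_assoc]

theorem topCoeff_eq_zero_of_mem {m : ℕ} {p : MvPolynomial (Fin m) (ZMod 2)}
    (hp : p ∈ lsIdeal m) : topCoeff m p = 0 := by
  classical
  suffices h : ∀ q, topCoeff m (q * p) = 0 by simpa using h 1
  rw [lsIdeal] at hp
  induction hp using Submodule.span_induction with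
  | mem g hg =>
    intro q
    induction q using MvPolynomial.induction_on' with
    | monomial e c =>
      have hc : (monomial e c : MvPolynomial (Fin m) (ZMod 2)) = c • monomial e 1 := by
        simp [smul_monomial]
      rw [hc, smul_mul_assoc, map_smul]
      rcases hg with ⟨i, j, hij, rfl⟩ | ⟨i, hi, rfl⟩
      · rw [sq, mul_add, map_add, monomial_mul_X_mul_X, monomial_mul_X_mul_X, topCoeff_monomial,
          topCoeff_monomial]
        rw [if_congr (isTopExponent_carry e hij) rfl rfl, CharTwo.add_self_eq_zero, smul_zero]
      · rw [sq, monomial_mul_X_mul_X, topCoeff_monomial, if_neg (not_isTopExponent_last e hi),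
          smul_zero]
    | add q r hq hr => rw [add_mul, map_add, hq, hr, add_zero]
  | zero => simp
  | add p r _ _ hp hr => intro q; rw [mul_add, map_add, hp, hr, add_zero]
  | smul a p _ hp => intro q; rw [smul_eq_mul, ← mul_assoc, hp]

theorem prod_X_notMem_lsIdeal (m : ℕ) :
    (∏ i : Fin m, X i : MvPolynomial (Fin m) (ZMod 2)) ∉ lsIdeal m := by
  intro h
  have hprod : (∏ i : Fin m, X i : MvPolynomial (Fin m) (ZMod 2)) =
      monomial (∑ i : Fin m, Finsupp.single i 1) 1 := by
    rw [monomial_sum_one]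
    rfl
  have he : ∀ t : Fin m, (∑ i : Fin m, Finsupp.single i 1 : Fin m →₀ ℕ) t = 1 := by
    intro t
    simp [Finsupp.finsetSum_apply, Finsupp.single_apply]
  have htop : IsTopExponent (∑ i : Fin m, Finsupp.single i 1) := by
    simp only [IsTopExponent, prefixSum, he]
    refine ⟨fun k hk => ?_, by simp⟩
    rw [← Finset.card_filter, Fin.card_filter_val_lt, min_eq_right hk]
  have := topCoeff_eq_zero_of_mem h
  rw [hprod, topCoeff_monomial, if_pos htop] at this
  exact one_ne_zero this

/-! ### The quotient by `lsIdeal` -/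

/-- The quotient ring `F₂[x₁,…,x_m]/I(m + 1)`. -/
abbrev LSRing (m : ℕ) : Type := MvPolynomial (Fin m) (ZMod 2) ⧸ lsIdeal m

/-- The class of the variable `X i` in `LSRing m`. -/
noncomputable def lsVar {m : ℕ} (i : Fin m) : LSRing m := Ideal.Quotient.mk (lsIdeal m) (X i)

theorem prod_lsVar_ne_zero (m : ℕ) : (∏ i : Fin m, lsVar i) ≠ 0 := by
  simp only [lsVar, ← map_prod, ne_eq, Ideal.Quotient.eq_zero_iff_mem]
  exact prod_X_notMem_lsIdeal m

instance lsRing_charP (m : ℕ) : CharP (LSRing m) 2 := by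
  have : Nontrivial (LSRing m) := nontrivial_of_ne _ _ (prod_lsVar_ne_zero m)
  exact charP_of_injective_algebraMap (algebraMap (ZMod 2) (LSRing m)).injective 2

theorem lsVar_sq {m : ℕ} {i j : Fin m} (hij : (j : ℕ) = i + 1) :
    lsVar i ^ 2 = lsVar i * lsVar j := by
  rw [← CharTwo.add_eq_zero, lsVar, lsVar, ← map_pow, ← map_mul, ← map_add,
    Ideal.Quotient.eq_zero_iff_mem]
  exact Ideal.subset_span (Or.inl ⟨i, j, hij, rfl⟩)

theorem lsVar_last_sq {m : ℕ} {i : Fin m} (hi : (i : ℕ) = m - 1) : lsVar i ^ 2 = 0 := by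
  rw [lsVar, ← map_pow, Ideal.Quotient.eq_zero_iff_mem]
  exact Ideal.subset_span (Or.inr ⟨i, hi, rfl⟩)

/-! ### Evaluating symmetric polynomials along a chain -/

namespace Multiset

variable {S : Type*} [CommRing S]

theorem esymm_zero_right (s : Multiset S) : s.esymm 0 = 1 := by
  simp [esymm]

theorem esymm_zero_succ (k : ℕ) : (0 : Multiset S).esymm (k + 1) = 0 := by
  simp [esymm, powersetCard_zero_right]

theorem esymm_cons_succ (a : S) (s : Multiset S) (k : ℕ) :
    (a ::ₘ s).esymm (k + 1) = s.esymm (k + 1) + a * s.esymm k := by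
  simp [esymm, powersetCard_cons, sum_map_mul_left]

theorem esymm_one (s : Multiset S) : s.esymm 1 = s.sum := by
  induction s using Multiset.induction_on with
  | empty => simp [esymm_zero_succ]
  | cons a s ih => rw [esymm_cons_succ, ih, esymm_zero_right, mul_one, sum_cons, add_comm]

theorem esymm_zero_cons (s : Multiset S) (k : ℕ) : ((0 : S) ::ₘ s).esymm k = s.esymm k := by
  cases k <;> simp [esymm_zero_right, esymm_cons_succ]

theorem esymm_cons_cons_self [CharP S 2] (a : S) (s : Multiset S) (k : ℕ) :
    (a ::ₘ a ::ₘ s).esymm (k + 2) = s.esymm (k + 2) + a ^ 2 * s.esymm k := by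
  simp only [esymm_cons_succ]
  linear_combination (CharTwo.add_self_eq_zero (a * s.esymm (k + 1)))

end Multiset

theorem esymm_map_range_getD {S : Type*} [CommRing S] (l : List S) {m : ℕ}
    (hm : l.length ≤ m) (k : ℕ) :
    ((Multiset.range m).map fun i => l.getD i 0).esymm k = (l : Multiset S).esymm k := by
  induction m, hm using Nat.le_induction with
  | base =>
    congr 1
    rw [Multiset.range, Multiset.map_coe]
    congr 1
    exact List.ext_getElem (by simp) (by intro i h1 h2; simp [h2])
  | succ m hm ih =>
    rw [Multiset.range_succ, Multiset.map_cons, List.getD_eq_default _ _ hm,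
      Multiset.esymm_zero_cons, ih]

theorem aeval_getD_esymm {S : Type*} [CommRing S] [Algebra (ZMod 2) S] (l : List S) {m : ℕ}
    (hm : l.length ≤ m) (k : ℕ) :
    aeval (fun i : Fin m => l.getD i 0) (esymm (Fin m) (ZMod 2) k) =
      (l : Multiset S).esymm k := by
  rw [aeval_esymm_eq_multiset_esymm, ← esymm_map_range_getD l hm k]
  congr 1
  rw [← Finset.range_val, ← Nat.Iio_eq_range, ← Fin.map_valEmbedding_univ, Finset.map_val,
    Multiset.map_map]
  rfl

theorem mul_aeval_eq_zero_of_mem_lsIdealHat {S : Type*} [CommRing S] [Algebra (ZMod 2) S]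
    {l : List S} (hl : (l ++ [0]).IsChain fun x y => x ^ 2 + x * y = 0) {a : S}
    (ha : a * l.sum = 0) {m : ℕ} (hm : l.length ≤ m) {p : MvPolynomial (Fin m) (ZMod 2)}
    (hp : p ∈ lsIdealHat m) : a * aeval (fun i : Fin m => l.getD i 0) p = 0 := by
  have hchain : ∀ i, l.getD i 0 ^ 2 + l.getD i 0 * l.getD (i + 1) 0 = 0 := by
    intro i
    rcases lt_or_ge i l.length with hi | hi
    · have h := hl.getElem i (by simpa using hi)
      rcases lt_or_ge (i + 1) l.length with hi' | hi'
      · simpa [hi, hi', List.getElem_append] using h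
      · simpa [hi, List.getElem_append, hi'.not_gt, List.getD_eq_default _ _ hi'] using h
    · rw [List.getD_eq_default _ _ hi]
      ring
  have hsum : aeval (fun i : Fin m => l.getD i 0)
      (∑ i, X i : MvPolynomial (Fin m) (ZMod 2)) = l.sum := by
    rw [← esymm_one, aeval_getD_esymm l hm, Multiset.esymm_one, Multiset.sum_coe]
  have hker : lsIdeal m ≤ RingHom.ker (aeval fun i : Fin m => l.getD i 0).toRingHom := by
    refine Ideal.span_le.2 ?_
    rintro _ (⟨i, j, hij, rfl⟩ | ⟨i, hi, rfl⟩)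
    · simpa [RingHom.mem_ker, hij] using hchain i
    · have h := hchain i
      rw [List.getD_eq_default l (n := (i : ℕ) + 1) _ (by omega)] at h
      simpa [RingHom.mem_ker] using h
  obtain ⟨q, hq, r, hr, rfl⟩ := Submodule.mem_sup.1 hp
  obtain ⟨t, rfl⟩ := Ideal.mem_span_singleton'.1 hr
  have hq' : aeval (fun i : Fin m => l.getD i 0) q = 0 := hker hq
  rw [map_add, hq', map_mul, hsum]
  linear_combination aeval (fun i : Fin m => l.getD i 0) t * ha

/-! ### Identities along a chain of five elements -/

section Chain

variable {R : Type*} [CommRing R] [CharP R 2] {c x₁ x₂ x₃ x₄ x₅ : R}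

theorem chain_mul_sum_cube (h₃ : x₃ ^ 2 = x₃ * x₄) (h₄ : x₄ ^ 2 = x₄ * x₅)
    (h₅ : c * x₅ ^ 2 = 0) : c * (x₃ + x₄ + x₅) ^ 3 = 0 := by
  grind

theorem chain_mul_sum_mul_e2_sq (h₁ : x₁ ^ 2 = x₁ * x₂) (h₂ : x₂ ^ 2 = x₂ * x₃)
    (h₃ : x₃ ^ 2 = x₃ * x₄) (h₄ : x₄ ^ 2 = x₄ * x₅) (h₅ : c * x₅ ^ 2 = 0) :
    c * ((x₃ + x₄ + x₅) * (x₁ ^ 2 + x₂ ^ 2 + (x₃ * x₄ + x₃ * x₅ + x₄ * x₅)) ^ 2) =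
      c * (x₁ * x₂ * x₃ * x₄ * x₅) := by
  grind

theorem chain_mul_e3_sq (h₁ : x₁ ^ 2 = x₁ * x₂) (h₂ : x₂ ^ 2 = x₂ * x₃)
    (h₃ : x₃ ^ 2 = x₃ * x₄) (h₅ : c * x₅ ^ 2 = 0) :
    c * ((x₁ ^ 2 + x₂ ^ 2) * (x₃ + x₄ + x₅) + x₃ * x₄ * x₅) ^ 2 = 0 := by
  grind

theorem chain_mul_e4_sq (h₁ : x₁ ^ 2 = x₁ * x₂) (h₂ : x₂ ^ 2 = x₂ * x₃)
    (h₃ : x₃ ^ 2 = x₃ * x₄) (h₄ : x₄ ^ 2 = x₄ * x₅) (h₅ : c * x₅ ^ 2 = 0) :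
    c * (x₁ ^ 2 * x₂ ^ 2 + (x₁ ^ 2 + x₂ ^ 2) * (x₃ * x₄ + x₃ * x₅ + x₄ * x₅)) ^ 2 = 0 := by
  grind

/-- An annihilator of `x₁ + ⋯ + x₅` along a chain of five elements. -/
def chainAnn (x₁ x₂ x₃ x₄ x₅ : R) : R :=
  x₁ * x₂ + x₁ * x₄ + x₁ * x₅ + x₂ * x₃ + x₂ * x₄ + x₂ * x₅ + x₃ * x₄ + x₃ * x₅ + x₄ * x₅

theorem chainAnn_mul_sum (h₁ : x₁ ^ 2 = x₁ * x₂) (h₂ : x₂ ^ 2 = x₂ * x₃)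
    (h₃ : x₃ ^ 2 = x₃ * x₄) (h₄ : x₄ ^ 2 = x₄ * x₅) (h₅ : x₅ ^ 2 = 0) :
    chainAnn x₁ x₂ x₃ x₄ x₅ * [x₁, x₂, x₃, x₄, x₅].sum = 0 := by
  simp only [chainAnn, List.sum_cons, List.sum_nil]
  grind

theorem chainAnn_mul_cube (h₁ : x₁ ^ 2 = x₁ * x₂) (h₂ : x₂ ^ 2 = x₂ * x₃)
    (h₃ : x₃ ^ 2 = x₃ * x₄) (h₄ : x₄ ^ 2 = x₄ * x₅) :
    chainAnn x₁ x₂ x₃ x₄ x₅ * x₁ ^ 3 = x₁ * x₂ * x₃ * x₄ * x₅ := by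
  simp only [chainAnn]
  grind

theorem chainAnn_mul_esymm_two_sq (h₁ : x₁ ^ 2 = x₁ * x₂) (h₂ : x₂ ^ 2 = x₂ * x₃)
    (h₃ : x₃ ^ 2 = x₃ * x₄) (h₄ : x₄ ^ 2 = x₄ * x₅) (h₅ : x₅ ^ 2 = 0) :
    chainAnn x₁ x₂ x₃ x₄ x₅ * ([x₁, x₂, x₃, x₄, x₅] : Multiset R).esymm 2 ^ 2 = 0 := by
  simp only [chainAnn, ← Multiset.cons_coe, Multiset.coe_nil, Multiset.esymm_cons_succ,
    Multiset.esymm_zero_right, Multiset.esymm_zero_succ]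
  grind

theorem chainAnn_mul_esymm_three (h₁ : x₁ ^ 2 = x₁ * x₂) (h₂ : x₂ ^ 2 = x₂ * x₃)
    (h₃ : x₃ ^ 2 = x₃ * x₄) (h₄ : x₄ ^ 2 = x₄ * x₅) (h₅ : x₅ ^ 2 = 0) :
    chainAnn x₁ x₂ x₃ x₄ x₅ * ([x₁, x₂, x₃, x₄, x₅] : Multiset R).esymm 3 =
      x₁ * x₂ * x₃ * x₄ * x₅ := by
  simp only [chainAnn, ← Multiset.cons_coe, Multiset.coe_nil, Multiset.esymm_cons_succ,
    Multiset.esymm_zero_right, Multiset.esymm_zero_succ]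
  grind

theorem chainAnn_mul_esymm_five (h₁ : x₁ ^ 2 = x₁ * x₂) (h₂ : x₂ ^ 2 = x₂ * x₃)
    (h₃ : x₃ ^ 2 = x₃ * x₄) (h₄ : x₄ ^ 2 = x₄ * x₅) (h₅ : x₅ ^ 2 = 0) :
    chainAnn x₁ x₂ x₃ x₄ x₅ * ([x₁, x₂, x₃, x₄, x₅] : Multiset R).esymm 5 = 0 := by
  simp only [chainAnn, ← Multiset.cons_coe, Multiset.coe_nil, Multiset.esymm_cons_succ,
    Multiset.esymm_zero_right, Multiset.esymm_zero_succ]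
  grind

end Chain

/-! ### The base cases -/

theorem mk_ne_zero_of_mul_aeval_eq_prod {j m : ℕ} {l : List (LSRing j)} {a : LSRing j}
    (hl : (l ++ [0]).IsChain fun x y => x ^ 2 + x * y = 0) (ha : a * l.sum = 0)
    (hm : l.length ≤ m) {p : MvPolynomial (Fin m) (ZMod 2)}
    (hp : a * aeval (fun i : Fin m => l.getD i 0) p = ∏ i : Fin j, lsVar i) :
    Ideal.Quotient.mk (lsIdealHat m) p ≠ 0 := by
  rw [ne_eq, Ideal.Quotient.eq_zero_iff_mem]
  intro h
  exact prod_lsVar_ne_zero j (hp.symm.trans (mul_aeval_eq_zero_of_mem_lsIdealHat hl ha hm h))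

theorem mk_esymm_two_ne_zero {m : ℕ} (hm : 4 ≤ m) :
    Ideal.Quotient.mk (lsIdealHat m) (esymm (Fin m) (ZMod 2) 2) ≠ 0 := by
  have h₀ : (lsVar 0 : LSRing 2) ^ 2 = lsVar 0 * lsVar 1 := lsVar_sq rfl
  have h₁ : (lsVar 1 : LSRing 2) ^ 2 = 0 := lsVar_last_sq rfl
  refine mk_ne_zero_of_mul_aeval_eq_prod (j := 2) (a := 1)
    (l := [lsVar 0, lsVar 0, lsVar 1, lsVar 1]) ?_ ?_ hm ?_
  · simp only [List.cons_append, List.nil_append, List.isChain_cons_cons, List.isChain_singleton]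
    grind
  · simp only [List.sum_cons, List.sum_nil]
    grind
  · rw [aeval_getD_esymm _ hm]
    simp only [← Multiset.cons_coe, Multiset.coe_nil, Multiset.esymm_cons_succ,
      Multiset.esymm_zero_right, Multiset.esymm_zero_succ, Fin.prod_univ_two]
    grind

theorem mk_esymm_three_ne_zero {m : ℕ} (hm : 5 ≤ m) :
    Ideal.Quotient.mk (lsIdealHat m) (esymm (Fin m) (ZMod 2) 3) ≠ 0 := by
  have h₀ : (lsVar 0 : LSRing 5) ^ 2 = lsVar 0 * lsVar 1 := lsVar_sq rfl
  have h₁ : (lsVar 1 : LSRing 5) ^ 2 = lsVar 1 * lsVar 2 := lsVar_sq rfl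
  have h₂ : (lsVar 2 : LSRing 5) ^ 2 = lsVar 2 * lsVar 3 := lsVar_sq rfl
  have h₃ : (lsVar 3 : LSRing 5) ^ 2 = lsVar 3 * lsVar 4 := lsVar_sq rfl
  have h₄ : (lsVar 4 : LSRing 5) ^ 2 = 0 := lsVar_last_sq rfl
  refine mk_ne_zero_of_mul_aeval_eq_prod (j := 5)
    (l := [lsVar 0, lsVar 1, lsVar 2, lsVar 3, lsVar 4]) ?_
    (chainAnn_mul_sum h₀ h₁ h₂ h₃ h₄) hm ?_
  · simp only [List.cons_append, List.nil_append, List.isChain_cons_cons, List.isChain_singleton]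
    grind
  · rw [aeval_getD_esymm _ hm, chainAnn_mul_esymm_three h₀ h₁ h₂ h₃ h₄, Fin.prod_univ_five]

theorem mk_esymm_two_sq_ne_zero {m : ℕ} (hm : 7 ≤ m) :
    Ideal.Quotient.mk (lsIdealHat m) (esymm (Fin m) (ZMod 2) 2 ^ 2) ≠ 0 := by
  have h₀ : (lsVar 0 : LSRing 6) ^ 2 = lsVar 0 * lsVar 1 := lsVar_sq rfl
  have h₁ : (lsVar 1 : LSRing 6) ^ 2 = lsVar 1 * lsVar 2 := lsVar_sq rfl
  have h₂ : (lsVar 2 : LSRing 6) ^ 2 = lsVar 2 * lsVar 3 := lsVar_sq rfl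
  have h₃ : (lsVar 3 : LSRing 6) ^ 2 = lsVar 3 * lsVar 4 := lsVar_sq rfl
  have h₄ : (lsVar 4 : LSRing 6) ^ 2 = lsVar 4 * lsVar 5 := lsVar_sq rfl
  have h₅ : (lsVar 5 : LSRing 6) ^ 2 = 0 := lsVar_last_sq rfl
  have hsum := chainAnn_mul_sum h₁ h₂ h₃ h₄ h₅
  have hcube := chainAnn_mul_cube h₁ h₂ h₃ h₄
  have hsq := chainAnn_mul_esymm_two_sq h₁ h₂ h₃ h₄ h₅
  refine mk_ne_zero_of_mul_aeval_eq_prod (j := 6)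
    (a := chainAnn (lsVar 1) (lsVar 2) (lsVar 3) (lsVar 4) (lsVar 5))
    (l := [lsVar 0, lsVar 0, lsVar 1, lsVar 2, lsVar 3, lsVar 4, lsVar 5]) ?_ ?_ hm ?_
  · simp only [List.cons_append, List.nil_append, List.isChain_cons_cons, List.isChain_singleton]
    grind
  · rw [List.sum_cons, List.sum_cons, ← add_assoc, CharTwo.add_self_eq_zero, zero_add, hsum]
  · rw [map_pow, aeval_getD_esymm _ hm, ← Multiset.cons_coe, ← Multiset.cons_coe,
      Multiset.esymm_cons_cons_self, Multiset.esymm_zero_right, Fin.prod_univ_six]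
    generalize chainAnn (lsVar 1 : LSRing 6) (lsVar 2) (lsVar 3) (lsVar 4) (lsVar 5) = b at *
    generalize Multiset.esymm (_ : Multiset (LSRing 6)) _ = e at *
    grind

theorem mk_esymm_five_ne_zero {m : ℕ} (hm : 9 ≤ m) :
    Ideal.Quotient.mk (lsIdealHat m) (esymm (Fin m) (ZMod 2) 5) ≠ 0 := by
  have h₀ : (lsVar 0 : LSRing 7) ^ 2 = lsVar 0 * lsVar 1 := lsVar_sq rfl
  have h₁ : (lsVar 1 : LSRing 7) ^ 2 = lsVar 1 * lsVar 2 := lsVar_sq rfl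
  have h₂ : (lsVar 2 : LSRing 7) ^ 2 = lsVar 2 * lsVar 3 := lsVar_sq rfl
  have h₃ : (lsVar 3 : LSRing 7) ^ 2 = lsVar 3 * lsVar 4 := lsVar_sq rfl
  have h₄ : (lsVar 4 : LSRing 7) ^ 2 = lsVar 4 * lsVar 5 := lsVar_sq rfl
  have h₅ : (lsVar 5 : LSRing 7) ^ 2 = lsVar 5 * lsVar 6 := lsVar_sq rfl
  have h₆ : (lsVar 6 : LSRing 7) ^ 2 = 0 := lsVar_last_sq rfl
  have hsum := chainAnn_mul_sum h₂ h₃ h₄ h₅ h₆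
  have hthree := chainAnn_mul_esymm_three h₂ h₃ h₄ h₅ h₆
  have hfive := chainAnn_mul_esymm_five h₂ h₃ h₄ h₅ h₆
  refine mk_ne_zero_of_mul_aeval_eq_prod (j := 7)
    (a := chainAnn (lsVar 2) (lsVar 3) (lsVar 4) (lsVar 5) (lsVar 6))
    (l := [lsVar 0, lsVar 0, lsVar 1, lsVar 1, lsVar 2, lsVar 3, lsVar 4, lsVar 5, lsVar 6])
    ?_ ?_ hm ?_
  · simp only [List.cons_append, List.nil_append, List.isChain_cons_cons, List.isChain_singleton]
    grind
  · rw [List.sum_cons, List.sum_cons, ← add_assoc, CharTwo.add_self_eq_zero, zero_add,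
      List.sum_cons, List.sum_cons, ← add_assoc, CharTwo.add_self_eq_zero, zero_add, hsum]
  · rw [← Multiset.sum_coe, ← Multiset.esymm_one] at hsum
    rw [aeval_getD_esymm _ hm]
    simp only [← Multiset.cons_coe (lsVar 0), ← Multiset.cons_coe (lsVar 1),
      Multiset.esymm_cons_cons_self, Fin.prod_univ_seven]
    generalize chainAnn (lsVar 2 : LSRing 7) (lsVar 3) (lsVar 4) (lsVar 5) (lsVar 6) = b at *
    generalize Multiset.esymm (_ : Multiset (LSRing 7)) 5 = e₅ at *
    generalize Multiset.esymm (_ : Multiset (LSRing 7)) 3 = e₃ at *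
    generalize Multiset.esymm (_ : Multiset (LSRing 7)) 1 = e₁ at *
    grind

theorem esymm_four_two_chains {R : Type*} [CommRing R] [CharP R 2]
    (x₁ x₂ x₃ x₄ x₅ x₆ x₇ x₈ x₉ x₁₀ x₁₁ : R) :
    ∃ r, ([x₁, x₁, x₂, x₂, x₃, x₄, x₅, x₆, x₇, x₇, x₈, x₈, x₉, x₁₀, x₁₁] :
      Multiset R).esymm 4 =
        (x₁ ^ 2 * x₂ ^ 2 + (x₁ ^ 2 + x₂ ^ 2) * (x₃ * x₄ + x₃ * x₅ + x₄ * x₅)) +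
        ((x₁ ^ 2 + x₂ ^ 2) * (x₃ + x₄ + x₅) + x₃ * x₄ * x₅) * (x₉ + x₁₀ + x₁₁) +
        (x₁ ^ 2 + x₂ ^ 2 + (x₃ * x₄ + x₃ * x₅ + x₄ * x₅)) *
          (x₇ ^ 2 + x₈ ^ 2 + (x₉ * x₁₀ + x₉ * x₁₁ + x₁₀ * x₁₁)) +
        (x₃ + x₄ + x₅) * ((x₇ ^ 2 + x₈ ^ 2) * (x₉ + x₁₀ + x₁₁) + x₉ * x₁₀ * x₁₁) +
        (x₇ ^ 2 * x₈ ^ 2 + (x₇ ^ 2 + x₈ ^ 2) * (x₉ * x₁₀ + x₉ * x₁₁ + x₁₀ * x₁₁)) + x₆ * r := by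
  have h : ([x₁, x₁, x₂, x₂, x₃, x₄, x₅, x₆, x₇, x₇, x₈, x₈, x₉, x₁₀, x₁₁] : Multiset R) =
      ([x₆, x₁, x₁, x₂, x₂, x₇, x₇, x₈, x₈, x₃, x₄, x₅, x₉, x₁₀, x₁₁] : Multiset R) := by
    simp only [← Multiset.cons_coe, Multiset.coe_nil, ← Multiset.singleton_add]
    abel
  refine ⟨([x₁, x₁, x₂, x₂, x₇, x₇, x₈, x₈, x₃, x₄, x₅, x₉, x₁₀, x₁₁] : Multiset R).esymm 3, ?_⟩
  rw [h, ← Multiset.cons_coe x₆, Multiset.esymm_cons_succ]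
  congr 1
  simp only [← Multiset.cons_coe, Multiset.coe_nil, Multiset.esymm_cons_cons_self]
  simp only [Multiset.esymm_cons_succ, Multiset.esymm_zero_right, Multiset.esymm_zero_succ]
  ring

theorem mul_sq_eq_of_two_chains {R : Type*} [CommRing R] [CharP R 2]
    {c x r L M p q a₂ a₃ a₄ b₂ b₃ b₄ : R} (hL : c * L ^ 3 = 0) (ha₂ : c * (L * a₂ ^ 2) = c * p)
    (ha₃ : c * a₃ ^ 2 = 0) (ha₄ : c * a₄ ^ 2 = 0) (hp : c * p * L = 0)
    (hb₂ : M * b₂ ^ 2 = q) (hb₃ : b₃ ^ 2 = 0) (hb₄ : b₄ ^ 2 = 0) (hq : q * M = 0)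
    (hx : c * x = 0) :
    c * (L ^ 2 + L * M + M ^ 2) * (a₄ + a₃ * M + a₂ * b₂ + L * b₃ + b₄ + x * r) ^ 2 =
      c * p * q := by
  simp only [CharTwo.add_sq, mul_pow]
  grind

theorem exists_annihilator_two_chains {R : Type*} [CommRing R] [CharP R 2]
    {x₁ x₂ x₃ x₄ x₅ x₆ x₇ x₈ x₉ x₁₀ x₁₁ : R}
    (h₁ : x₁ ^ 2 = x₁ * x₂) (h₂ : x₂ ^ 2 = x₂ * x₃) (h₃ : x₃ ^ 2 = x₃ * x₄)
    (h₄ : x₄ ^ 2 = x₄ * x₅) (h₅ : x₅ ^ 2 = x₅ * x₆) (h₆ : x₆ ^ 2 = x₆ * x₇)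
    (h₇ : x₇ ^ 2 = x₇ * x₈) (h₈ : x₈ ^ 2 = x₈ * x₉) (h₉ : x₉ ^ 2 = x₉ * x₁₀)
    (h₁₀ : x₁₀ ^ 2 = x₁₀ * x₁₁) (h₁₁ : x₁₁ ^ 2 = 0) :
    ∃ a, a * [x₁, x₁, x₂, x₂, x₃, x₄, x₅, x₆, x₇, x₇, x₈, x₈, x₉, x₁₀, x₁₁].sum = 0 ∧
      a * ([x₁, x₁, x₂, x₂, x₃, x₄, x₅, x₆, x₇, x₇, x₈, x₈, x₉, x₁₀, x₁₁] :
        Multiset R).esymm 4 ^ 2 = x₁ * x₂ * x₃ * x₄ * x₅ * x₆ * x₇ * x₈ * x₉ * x₁₀ * x₁₁ := by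
  obtain ⟨r, hr⟩ := esymm_four_two_chains x₁ x₂ x₃ x₄ x₅ x₆ x₇ x₈ x₉ x₁₀ x₁₁
  obtain ⟨c, hc⟩ : ∃ c, c = x₆ + x₇ := ⟨_, rfl⟩
  have hcx₆ : c * x₆ = 0 := by grind
  have hcx₅ : c * x₅ ^ 2 = 0 := by grind
  have h₁₁' : 1 * x₁₁ ^ 2 = 0 := by rw [h₁₁, mul_zero]
  have hcube := chain_mul_sum_cube h₃ h₄ hcx₅
  have he2 := chain_mul_sum_mul_e2_sq h₁ h₂ h₃ h₄ hcx₅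
  have he3 := chain_mul_e3_sq h₁ h₂ h₃ hcx₅
  have he4 := chain_mul_e4_sq h₁ h₂ h₃ h₄ hcx₅
  have hcube' := chain_mul_sum_cube h₉ h₁₀ h₁₁'
  have he2' := chain_mul_sum_mul_e2_sq h₇ h₈ h₉ h₁₀ h₁₁'
  have he3' := chain_mul_e3_sq h₇ h₈ h₉ h₁₁'
  have he4' := chain_mul_e4_sq h₇ h₈ h₉ h₁₀ h₁₁'
  simp only [one_mul] at hcube' he2' he3' he4'
  have htop : c * (x₁ * x₂ * x₃ * x₄ * x₅) * (x₃ + x₄ + x₅) = 0 := by grind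
  have htop' : (x₇ * x₈ * x₉ * x₁₀ * x₁₁) * (x₉ + x₁₀ + x₁₁) = 0 := by grind
  have hpush : x₇ * (x₇ * x₈ * x₉ * x₁₀ * x₁₁) = 0 := by grind
  refine ⟨c * ((x₃ + x₄ + x₅) ^ 2 + (x₃ + x₄ + x₅) * (x₉ + x₁₀ + x₁₁) +
    (x₉ + x₁₀ + x₁₁) ^ 2), ?_, ?_⟩
  · simp only [List.sum_cons, List.sum_nil]
    generalize hL : x₃ + x₄ + x₅ = L at *
    generalize hM : x₉ + x₁₀ + x₁₁ = M at *
    linear_combination (c * (L ^ 2 + L * M + M ^ 2)) * (hL + hM) + hcube + c * hcube' +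
      (L ^ 2 + L * M + M ^ 2) * hcx₆ + (c * (L ^ 2 + L * M + M ^ 2) *
        (x₁ + x₂ + x₇ + x₈) + c * (L ^ 2 * M + L * M ^ 2)) * CharTwo.two_eq_zero (R := R)
  · rw [hr, mul_sq_eq_of_two_chains hcube he2 he3 he4 htop he2' he3' he4' htop' hcx₆]
    linear_combination (x₁ * x₂ * x₃ * x₄ * x₅) * hpush +
      (x₁ * x₂ * x₃ * x₄ * x₅ * (x₇ * x₈ * x₉ * x₁₀ * x₁₁)) * hc

theorem mk_esymm_four_sq_ne_zero {m : ℕ} (hm : 15 ≤ m) :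
    Ideal.Quotient.mk (lsIdealHat m) (esymm (Fin m) (ZMod 2) 4 ^ 2) ≠ 0 := by
  have h₀ : (lsVar 0 : LSRing 11) ^ 2 = lsVar 0 * lsVar 1 := lsVar_sq rfl
  have h₁ : (lsVar 1 : LSRing 11) ^ 2 = lsVar 1 * lsVar 2 := lsVar_sq rfl
  have h₂ : (lsVar 2 : LSRing 11) ^ 2 = lsVar 2 * lsVar 3 := lsVar_sq rfl
  have h₃ : (lsVar 3 : LSRing 11) ^ 2 = lsVar 3 * lsVar 4 := lsVar_sq rfl
  have h₄ : (lsVar 4 : LSRing 11) ^ 2 = lsVar 4 * lsVar 5 := lsVar_sq rfl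
  have h₅ : (lsVar 5 : LSRing 11) ^ 2 = lsVar 5 * lsVar 6 := lsVar_sq rfl
  have h₆ : (lsVar 6 : LSRing 11) ^ 2 = lsVar 6 * lsVar 7 := lsVar_sq rfl
  have h₇ : (lsVar 7 : LSRing 11) ^ 2 = lsVar 7 * lsVar 8 := lsVar_sq rfl
  have h₈ : (lsVar 8 : LSRing 11) ^ 2 = lsVar 8 * lsVar 9 := lsVar_sq rfl
  have h₉ : (lsVar 9 : LSRing 11) ^ 2 = lsVar 9 * lsVar 10 := lsVar_sq rfl
  have h₁₀ : (lsVar 10 : LSRing 11) ^ 2 = 0 := lsVar_last_sq rfl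
  obtain ⟨a, hsum, hesymm⟩ :=
    exists_annihilator_two_chains h₀ h₁ h₂ h₃ h₄ h₅ h₆ h₇ h₈ h₉ h₁₀
  refine mk_ne_zero_of_mul_aeval_eq_prod (j := 11) ?_ hsum hm ?_
  · simp only [List.cons_append, List.nil_append, List.isChain_cons_cons, List.isChain_singleton]
    clear hsum hesymm
    grind
  · rw [map_pow, aeval_getD_esymm _ hm, hesymm]
    simp only [Fin.prod_univ_castSucc, Fin.prod_univ_zero, one_mul]
    rfl

/-- In `F₂[x₁,…,x_{n−1}]/Î(n)`: (1) for `n ≥ 5` the image of `σ₂` is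
nonzero; (2) for `n ≥ 6` the image of `σ₃` is nonzero; (3) for `n ≥ 8` the image of `σ₂²`
is nonzero; (4) for `n ≥ 10` the image of `σ₅` is nonzero; (5) for `n ≥ 16` the image of
`σ₄²` is nonzero.  (These express that the orientable double cover of the Lee–Szczarba
flat `n`-manifold is non-spin for `n ≥ 5`, non-spin^c for `n ≥ 6`, has `p₁ ≠ 0` for
`n ≥ 8`, is non-spin^h for `n ≥ 10`, and has `p₂ ≠ 0` for `n ≥ 16`.) -/
theorem stmt18 (n : ℕ) :
    (5 ≤ n → Ideal.Quotient.mk (lsIdealHat (n - 1)) (esymm (Fin (n - 1)) (ZMod 2) 2) ≠ 0) ∧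
    (6 ≤ n → Ideal.Quotient.mk (lsIdealHat (n - 1)) (esymm (Fin (n - 1)) (ZMod 2) 3) ≠ 0) ∧
    (8 ≤ n →
      Ideal.Quotient.mk (lsIdealHat (n - 1)) (esymm (Fin (n - 1)) (ZMod 2) 2 ^ 2) ≠ 0) ∧
    (10 ≤ n → Ideal.Quotient.mk (lsIdealHat (n - 1)) (esymm (Fin (n - 1)) (ZMod 2) 5) ≠ 0) ∧
    (16 ≤ n →
      Ideal.Quotient.mk (lsIdealHat (n - 1)) (esymm (Fin (n - 1)) (ZMod 2) 4 ^ 2) ≠ 0) := by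
  refine ⟨fun h => mk_esymm_two_ne_zero (by omega), fun h => mk_esymm_three_ne_zero (by omega),
    fun h => mk_esymm_two_sq_ne_zero (by omega), fun h => mk_esymm_five_ne_zero (by omega),
    fun h => mk_esymm_four_sq_ne_zero (by omega)⟩
end
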